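/- There exists an absolute constant C > 0 such that for all integers n ≥ 2 and 2 ≤ l ≤ k ≤ n and every real 1 < δ ≤ 2, there exists a δ-balanced (n,k,l)-splitter of size at most 2^{C·(k·log l + log(1/(δ−1)))}·log n. -/

import Mathlib

open Finset

attribute [local instance] Classical.propDecidable

/-- The number of functions in the family `F` (indexed by `ι`) that are injective
on the set `S`. -/
noncomputable def injCount {n l N : ℕ} (F : Fin N → Fin n → Fin l) (S : Finset (Fin n)) : ℕ :=
  (Finset.univ.filter fun i => Set.InjOn (F i) ↑S).card

/-- `split(S)`: if `k ≤ l` this counts the functions injective on `S`; if `k > l` it counts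
the functions whose first `k mod l` color classes within `S` have size `⌈k/l⌉` and whose
remaining color classes within `S` have size `⌊k/l⌋`. -/
noncomputable def splitCount {n l N : ℕ} (k : ℕ) (F : Fin N → Fin n → Fin l)
    (S : Finset (Fin n)) : ℕ :=
  if k ≤ l then injCount F S
  else (Finset.univ.filter fun i : Fin N => ∀ j : Fin l,
    (S.filter fun x => F i x = j).card =
      (if (j : ℕ) < k % l then (k + l - 1) / l else k / l)).card

/-- `F` is a `δ`-balanced `(n,k,l)`-splitter. -/
noncomputable def IsBalancedSplitter {n l N : ℕ} (k : ℕ) (δ : ℝ)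
    (F : Fin N → Fin n → Fin l) : Prop :=
  ∃ T : ℝ, 0 < T ∧ ∀ S : Finset (Fin n), S.card = k →
    T / δ ≤ (splitCount k F S : ℝ) ∧ (splitCount k F S : ℝ) ≤ δ * T

/-- The method of conditional expectations: for finitely many tests with mean zero and values in
`[-1, 1]`, some sequence of `N` points keeps all exponential sums below their average. -/
theorem exists_sum_exp_le {Ω J : Type*} [Fintype Ω] [Nonempty Ω] (s : Finset J) (Y : J → Ω → ℝ)
    (hmean : ∀ j ∈ s, ∑ ω, Y j ω = 0) (hbd : ∀ j ∈ s, ∀ ω, |Y j ω| ≤ 1)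
    {t : ℝ} (ht0 : 0 ≤ t) (ht1 : t ≤ 1) (N : ℕ) :
    ∃ h : Fin N → Ω, ∑ j ∈ s, Real.exp (t * ∑ i, Y j (h i)) ≤ s.card * Real.exp (t ^ 2 * N) := by
  induction N with
  | zero => exact ⟨fun i => i.elim0, by simp⟩
  | succ N ih =>
    obtain ⟨h, hh⟩ := ih
    have hstep : ∀ j ∈ s, ∑ ω, Real.exp (t * Y j ω) ≤ Fintype.card Ω * Real.exp (t ^ 2) := by
      intro j hj
      calc ∑ ω, Real.exp (t * Y j ω) ≤ ∑ ω, (1 + t ^ 2 + t * Y j ω) := by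
            refine Finset.sum_le_sum fun ω _ => ?_
            have h1 : |t * Y j ω| ≤ 1 := by
              rw [abs_mul, abs_of_nonneg ht0]
              exact mul_le_one₀ ht1 (abs_nonneg _) (hbd j hj ω)
            have h2 := (abs_le.1 (Real.abs_exp_sub_one_sub_id_le h1)).2
            have h3 : (Y j ω) ^ 2 ≤ 1 := (sq_le_one_iff_abs_le_one _).2 (hbd j hj ω)
            nlinarith [mul_le_mul_of_nonneg_left h3 (sq_nonneg t)]
        _ = Fintype.card Ω * (1 + t ^ 2) := by
            rw [Finset.sum_add_distrib, ← Finset.mul_sum, hmean j hj, Finset.sum_const,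
              Finset.card_univ, nsmul_eq_mul]
            ring
        _ ≤ Fintype.card Ω * Real.exp (t ^ 2) := by
            gcongr
            linarith [Real.add_one_le_exp (t ^ 2)]
    have havg : ∑ ω, ∑ j ∈ s, Real.exp (t * ∑ i, Y j (h i)) * Real.exp (t * Y j ω) ≤
        ∑ _ω : Ω, s.card * Real.exp (t ^ 2 * (N + 1 : ℕ)) := by
      rw [Finset.sum_comm]
      calc ∑ j ∈ s, ∑ ω, Real.exp (t * ∑ i, Y j (h i)) * Real.exp (t * Y j ω)
          ≤ ∑ j ∈ s, Real.exp (t * ∑ i, Y j (h i)) * (Fintype.card Ω * Real.exp (t ^ 2)) := by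
            refine Finset.sum_le_sum fun j hj => ?_
            rw [← Finset.mul_sum]
            exact mul_le_mul_of_nonneg_left (hstep j hj) (Real.exp_pos _).le
        _ ≤ (s.card * Real.exp (t ^ 2 * N)) * (Fintype.card Ω * Real.exp (t ^ 2)) := by
            rw [← Finset.sum_mul]
            gcongr
        _ = ∑ _ω : Ω, s.card * Real.exp (t ^ 2 * (N + 1 : ℕ)) := by
            rw [Finset.sum_const, Finset.card_univ, nsmul_eq_mul]
            push_cast
            rw [mul_add, Real.exp_add, mul_one]
            ring
    obtain ⟨ω, -, hω⟩ := Finset.exists_le_of_sum_le Finset.univ_nonempty havg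
    refine ⟨Fin.cons ω h, le_trans (le_of_eq ?_) hω⟩
    refine Finset.sum_congr rfl fun j _ => ?_
    rw [Fin.sum_univ_succ, ← Real.exp_add]
    simp only [Fin.cons_zero, Fin.cons_succ]
    ring_nf

/-- A finite-sample uniform tail bound for mean-zero tests with values in `[-1, 1]`. -/
theorem exists_forall_sum_le {Ω J : Type*} [Fintype Ω] [Nonempty Ω] (s : Finset J) (Y : J → Ω → ℝ)
    (hmean : ∀ j ∈ s, ∑ ω, Y j ω = 0) (hbd : ∀ j ∈ s, ∀ ω, |Y j ω| ≤ 1)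
    {a : ℝ} (ha0 : 0 < a) (ha1 : a ≤ 1) (N : ℕ) (hN : 4 * Real.log s.card ≤ a ^ 2 * N) :
    ∃ h : Fin N → Ω, ∀ j ∈ s, ∑ i, Y j (h i) ≤ a * N := by
  obtain ⟨h, hh⟩ := exists_sum_exp_le s Y hmean hbd (t := a / 2) (by linarith) (by linarith) N
  refine ⟨h, fun j hj => ?_⟩
  have h1 := (Finset.single_le_sum (f := fun j => Real.exp (a / 2 * ∑ i, Y j (h i)))
    (fun _ _ => (Real.exp_pos _).le) hj).trans hh
  have hs : (0 : ℝ) < s.card := by exact_mod_cast Finset.card_pos.2 ⟨j, hj⟩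
  have h2 := Real.log_le_log (Real.exp_pos _) h1
  rw [Real.log_exp, Real.log_mul hs.ne' (Real.exp_pos _).ne', Real.log_exp] at h2
  have h3 : a / 2 * ∑ i, Y j (h i) ≤ a / 2 * (a * N) := by nlinarith
  exact le_of_mul_le_mul_left h3 (by linarith)

/-- The function `f` splits `S` in the sense counted by `splitCount`. -/
def Splits {n l : ℕ} (k : ℕ) (f : Fin n → Fin l) (S : Finset (Fin n)) : Prop :=
  if k ≤ l then Set.InjOn f ↑S
  else ∀ j : Fin l, (S.filter fun x => f x = j).card =
      (if (j : ℕ) < k % l then (k + l - 1) / l else k / l)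

theorem splitCount_eq_card_filter {n l N : ℕ} (k : ℕ) (F : Fin N → Fin n → Fin l)
    (S : Finset (Fin n)) :
    splitCount k F S = (Finset.univ.filter fun i => Splits k (F i) S).card := by
  unfold splitCount injCount Splits
  split_ifs <;> rfl

theorem Splits.congr {n l k : ℕ} {f g : Fin n → Fin l} {S : Finset (Fin n)}
    (hf : Splits k f S) (hfg : ∀ x ∈ S, f x = g x) : Splits k g S := by
  unfold Splits at *
  split_ifs at * with h
  · exact hf.congr hfg
  · intro j
    rw [← hf j]
    congr 1
    exact Finset.filter_congr fun x hx => by rw [hfg x hx]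

theorem splits_comp_iff {n l k : ℕ} (f : Fin n → Fin l) (σ : Equiv.Perm (Fin n))
    (S : Finset (Fin n)) : Splits k (f ∘ σ) S ↔ Splits k f (S.map σ.toEmbedding) := by
  unfold Splits
  split_ifs with h
  · rw [Finset.coe_map]
    exact (σ.injective.injOn.comp_iff)
  · refine forall_congr' fun j => ?_
    rw [Finset.filter_map, Finset.card_map]
    rfl

theorem card_filter_splits_eq {n l k : ℕ} {S S' : Finset (Fin n)} (h : S.card = S'.card) :
    (Finset.univ.filter fun f : Fin n → Fin l => Splits k f S).card =
      (Finset.univ.filter fun f : Fin n → Fin l => Splits k f S').card := by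
  let e : {x // x ∈ S} ≃ {x // x ∈ S'} := Finset.equivOfCardEq h
  let σ := e.extendSubtype
  have hσ : S.map σ.toEmbedding = S' := by
    refine Finset.eq_of_subset_of_card_le ?_ (by rw [Finset.card_map, h])
    intro y hy
    obtain ⟨x, hx, rfl⟩ := Finset.mem_map.1 hy
    exact e.extendSubtype_mem x hx
  symm
  refine Finset.card_bij (fun f _ => f ∘ σ) ?_ ?_ ?_
  · intro f hf
    simpa [splits_comp_iff, hσ] using hf
  · intro f _ g _ hfg
    exact σ.surjective.injective_comp_right hfg
  · intro f hf
    refine ⟨f ∘ σ.symm, ?_, by ext; simp⟩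
    rw [← hσ]
    simp only [Finset.mem_filter, Finset.mem_univ, true_and, ← splits_comp_iff] at hf ⊢
    convert hf using 1
    ext; simp

theorem splits_mod {n k l : ℕ} (hl : 0 < l) (hkn : k ≤ n) :
    Splits k (fun x : Fin n => (⟨x % l, Nat.mod_lt _ hl⟩ : Fin l))
      (Finset.univ.filter fun x : Fin n => (x : ℕ) < k) := by
  unfold Splits
  split_ifs with h
  · intro x hx y hy hxy
    simp only [Finset.coe_filter, Finset.mem_univ, true_and, Set.mem_ofPred_eq] at hx hy
    simp only [Fin.mk.injEq] at hxy
    rw [Nat.mod_eq_of_lt (hx.trans_le h), Nat.mod_eq_of_lt (hy.trans_le h)] at hxy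
    exact Fin.ext hxy
  · intro j
    have h1 : (Finset.filter (fun x : Fin n => (⟨x % l, Nat.mod_lt _ hl⟩ : Fin l) = j)
        (Finset.univ.filter fun x : Fin n => (x : ℕ) < k)).card = k.count (· ≡ j [MOD l]) := by
      rw [Nat.count_eq_card_filter_range]
      refine Finset.card_bij (fun x _ => (x : ℕ)) ?_ (fun _ _ _ _ => Fin.ext) ?_
      · intro x hx
        simp only [Finset.mem_filter, Finset.mem_univ, true_and, Fin.ext_iff] at hx
        simp [Nat.ModEq, hx, Nat.mod_eq_of_lt j.2]
      · intro x hx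
        simp only [Finset.mem_filter, Finset.mem_range, Nat.ModEq, Nat.mod_eq_of_lt j.2] at hx
        exact ⟨⟨x, hx.1.trans_le hkn⟩, by simp [Fin.ext_iff, hx], rfl⟩
    rw [h1, Nat.count_modEq_card _ hl, Nat.mod_eq_of_lt j.2]
    split_ifs with hj
    · have h2 := Nat.div_add_mod k l
      symm
      rw [show k + l - 1 = (k - 1) + l by omega, Nat.add_div_right _ hl]
      have := Nat.mod_lt k hl
      congr 1
      rw [Nat.div_eq_iff hl, mul_comm]
      omega
    · simp

theorem pow_le_card_filter_splits_mul {n k l : ℕ} {S : Finset (Fin n)} {g : Fin n → Fin l}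
    (hg : Splits k g S) :
    l ^ n ≤ (Finset.univ.filter fun f : Fin n → Fin l => Splits k f S).card * l ^ S.card := by
  have h := Finset.card_le_card_of_injOn (s := (Finset.univ : Finset (Fin n → Fin l)))
    (t := (Finset.univ.filter fun f : Fin n → Fin l => Splits k f S) ×ˢ
      (Finset.univ : Finset ({x // x ∈ S} → Fin l)))
    (fun f => (fun x => if x ∈ S then g x else f x, fun x => f x)) ?_ ?_
  · simpa [Finset.card_product] using h
  · intro f _
    simp only [Finset.coe_product, Set.mem_prod, Finset.mem_coe, Finset.mem_filter,
      Finset.mem_univ, true_and, and_true]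
    exact hg.congr fun x hx => by simp [hx]
  · intro f _ f' _ hff
    simp only [Prod.mk.injEq] at hff
    funext x
    by_cases hx : x ∈ S
    · exact congrFun hff.2 ⟨x, hx⟩
    · simpa [hx] using congrFun hff.1 x

/-- All `k`-sets are split by the same proportion `p ≥ l⁻ᵏ` of the functions. -/
theorem exists_card_filter_splits_eq {n k l : ℕ} (hl : 0 < l) (hkn : k ≤ n) :
    ∃ p : ℝ, ((l : ℝ) ^ k)⁻¹ ≤ p ∧ p ≤ 1 ∧ ∀ S : Finset (Fin n), S.card = k →
      ((Finset.univ.filter fun f : Fin n → Fin l => Splits k f S).card : ℝ) = p * (l : ℝ) ^ n := by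
  set S₀ := Finset.univ.filter fun x : Fin n => (x : ℕ) < k with hS₀
  have hcard : S₀.card = k := by simp [hS₀, Fin.card_filter_val_lt, hkn]
  have hl' : (0 : ℝ) < l := by exact_mod_cast hl
  have h1 := pow_le_card_filter_splits_mul (splits_mod hl hkn)
  rw [← hS₀, hcard] at h1
  have h2 := Finset.card_filter_le (Finset.univ : Finset (Fin n → Fin l)) (fun f => Splits k f S₀)
  simp only [Finset.card_univ, Fintype.card_fun, Fintype.card_fin] at h2
  refine ⟨(Finset.univ.filter fun f : Fin n → Fin l => Splits k f S₀).card / (l : ℝ) ^ n,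
    ?_, ?_, ?_⟩
  · rw [inv_le_iff_one_le_mul₀ (by positivity), div_mul_eq_mul_div, one_le_div (by positivity)]
    exact_mod_cast h1
  · rw [div_le_one (by positivity)]
    exact_mod_cast h2
  · intro S hS
    rw [div_mul_cancel₀ _ (by positivity), card_filter_splits_eq (hS.trans hcard.symm)]

theorem sum_indicator_sub_eq {Ω : Type*} [Fintype Ω] (P : Ω → Prop) (p : ℝ) :
    ∑ ω, ((if P ω then 1 else 0) - p) =
      ((Finset.univ.filter P).card : ℝ) - Fintype.card Ω * p := by
  simp [Finset.sum_sub_distrib]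

theorem exists_isBalancedSplitter {n k l : ℕ} (hl : 0 < l) (hlk : l ≤ k) (hkn : k ≤ n)
    (hn : 2 ≤ n) {δ : ℝ} (hδ1 : 1 < δ) (hδ2 : δ ≤ 2) (N : ℕ)
    (hN : 32 * k * (l : ℝ) ^ (2 * k) * Real.log n ≤ (δ - 1) ^ 2 * N) :
    ∃ F : Fin N → Fin n → Fin l, IsBalancedSplitter k δ F := by
  have : Nonempty (Fin l) := ⟨⟨0, hl⟩⟩
  obtain ⟨p, hp, hp1, hpS⟩ := exists_card_filter_splits_eq hl hkn
  have hl' : (0 : ℝ) < l := by exact_mod_cast hl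
  have hk' : (0 : ℝ) < k := by exact_mod_cast hl.trans_le hlk
  have hlog : 0 < Real.log n := Real.log_pos (by exact_mod_cast hn)
  have hp0 : 0 < p := lt_of_lt_of_le (by positivity) hp
  have hNpos : (0 : ℝ) < N := by
    by_contra hcon
    have : (0 : ℝ) < 32 * k * (l : ℝ) ^ (2 * k) * Real.log n := by positivity
    nlinarith [sq_nonneg (δ - 1)]
  set s : Finset (Finset (Fin n) × Bool) := Finset.powersetCard k Finset.univ ×ˢ Finset.univ with hs
  let Y : Finset (Fin n) × Bool → (Fin n → Fin l) → ℝ := fun j f =>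
    (if j.2 then 1 else -1) * ((if Splits k f j.1 then 1 else 0) - p)
  have hscard : s.card ≤ n ^ (2 * k) := by
    rw [hs, Finset.card_product, Finset.card_powersetCard, Finset.card_univ, Finset.card_univ,
      Fintype.card_fin, Fintype.card_bool, two_mul, pow_add]
    exact Nat.mul_le_mul (Nat.choose_le_pow n k)
      (hn.trans (Nat.le_self_pow (hl.trans_le hlk).ne' n))
  have hlogs : Real.log s.card ≤ 2 * k * Real.log n := by
    rcases Nat.eq_zero_or_pos s.card with h0 | h0
    · rw [h0, Nat.cast_zero, Real.log_zero]
      positivity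
    · have := Real.log_le_log (by exact_mod_cast h0) (show (s.card : ℝ) ≤ (n : ℝ) ^ (2 * k) by
        exact_mod_cast hscard)
      rw [Real.log_pow] at this
      exact_mod_cast this
  have hq : ((l : ℝ) ^ k)⁻¹ ≤ 1 := hp.trans hp1
  have hex : ∃ F : Fin N → Fin n → Fin l, ∀ j ∈ s,
      ∑ i, Y j (F i) ≤ (δ - 1) / 2 * ((l : ℝ) ^ k)⁻¹ * N := by
    refine exists_forall_sum_le s Y ?_ ?_ ?_ ?_ N ?_
    · rintro ⟨S, b⟩ hj
      have hS : S.card = k := by simpa [hs] using hj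
      simp only [Y, ← Finset.mul_sum, sum_indicator_sub_eq, hpS S hS]
      simp [mul_comm]
    · rintro ⟨S, b⟩ - f
      have h1 : |(if b then (1 : ℝ) else -1)| = 1 := by cases b <;> simp
      simp only [Y, abs_mul, h1, one_mul]
      rw [abs_le]
      split_ifs <;> constructor <;> linarith
    · have : 0 < δ - 1 := by linarith
      positivity
    · exact mul_le_one₀ (by linarith) (by positivity) hq
    · have h1 : ((δ - 1) / 2 * ((l : ℝ) ^ k)⁻¹) ^ 2 * N =
          ((δ - 1) ^ 2 * N) / (4 * (l : ℝ) ^ (2 * k)) := by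
        rw [mul_comm 2 k, pow_mul]
        field_simp
        ring
      rw [h1, le_div_iff₀ (by positivity)]
      refine le_trans ?_ hN
      calc 4 * Real.log s.card * (4 * (l : ℝ) ^ (2 * k))
          ≤ 4 * (2 * k * Real.log n) * (4 * (l : ℝ) ^ (2 * k)) := by gcongr
        _ = _ := by ring
  obtain ⟨F, hF⟩ := hex
  refine ⟨F, p * N, by positivity, fun S hS => ?_⟩
  have hsum : ∑ i, ((if Splits k (F i) S then 1 else 0) - p) = splitCount k F S - N * p := by
    rw [sum_indicator_sub_eq, splitCount_eq_card_filter, Fintype.card_fin]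
  have hup := hF (S, true) (by simp [hs, hS])
  have hlo := hF (S, false) (by simp [hs, hS])
  simp only [Y, ← Finset.mul_sum, hsum, if_true, Bool.false_eq_true, if_false] at hup hlo
  have hdev : (δ - 1) / 2 * ((l : ℝ) ^ k)⁻¹ * N ≤ (δ - 1) / 2 * (p * N) := by
    rw [mul_assoc]
    gcongr
  have hpN : 0 < p * N := by positivity
  constructor
  · rw [div_le_iff₀ (by linarith)]
    have h1 : (1 - (δ - 1) / 2) * (p * N) ≤ splitCount k F S := by nlinarith
    have h2 : 1 ≤ (1 - (δ - 1) / 2) * δ := by nlinarith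
    calc p * N ≤ ((1 - (δ - 1) / 2) * δ) * (p * N) := le_mul_of_one_le_left hpN.le h2
      _ = ((1 - (δ - 1) / 2) * (p * N)) * δ := by ring
      _ ≤ _ := by gcongr
  · nlinarith

theorem two_rpow_mul_logb_add {k l m : ℕ} (hl : 0 < l) {x : ℝ} (hx : 0 < x) :
    (2 : ℝ) ^ ((m : ℝ) * ((k : ℝ) * Real.logb 2 l + Real.logb 2 x)) = ((l : ℝ) ^ k * x) ^ m := by
  have hl' : (0 : ℝ) < l := by exact_mod_cast hl
  rw [mul_comm (m : ℝ), Real.rpow_mul (by norm_num), Real.rpow_natCast, ← Real.logb_pow,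
    ← Real.logb_mul (by positivity) hx.ne', Real.rpow_logb (by norm_num) (by norm_num)
      (by positivity)]

/-- there is an absolute constant `C > 0` such that for all `2 ≤ l ≤ k ≤ n`,
`n ≥ 2`, and `1 < δ ≤ 2`, there exists a `δ`-balanced `(n,k,l)`-splitter of size at most
`2^{C·(k·log₂ l + log₂(1/(δ−1)))}·log₂ n`. -/
theorem stmt7 :
    ∃ C : ℝ, 0 < C ∧ ∀ n k l : ℕ, 2 ≤ l → l ≤ k → k ≤ n → 2 ≤ n →
      ∀ δ : ℝ, 1 < δ → δ ≤ 2 →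
        ∃ (N : ℕ) (F : Fin N → Fin n → Fin l),
          IsBalancedSplitter k δ F ∧
          (N : ℝ) ≤ 2 ^ (C * ((k : ℝ) * Real.logb 2 l + Real.logb 2 (1 / (δ - 1)))) *
            Real.logb 2 n := by
  refine ⟨6, by norm_num, fun n k l hl hlk hkn hn δ hδ1 hδ2 => ?_⟩
  have hδ : 0 < δ - 1 := by linarith
  set x : ℝ := 32 * k * (l : ℝ) ^ (2 * k) * Real.log n / (δ - 1) ^ 2 with hx
  obtain ⟨F, hF⟩ := exists_isBalancedSplitter (by omega) hlk hkn hn hδ1 hδ2 ⌈x⌉₊ (by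
    rw [← div_le_iff₀' (by positivity)]
    exact Nat.le_ceil x)
  refine ⟨⌈x⌉₊, F, hF, ?_⟩
  have hpow := two_rpow_mul_logb_add (k := k) (l := l) (m := 6) (by omega)
    (one_div_pos.2 hδ)
  rw [Nat.cast_ofNat] at hpow
  rw [hpow]
  have hn' : (2 : ℝ) ≤ n := by exact_mod_cast hn
  have hL1 : 1 ≤ Real.logb 2 n := by
    rw [Real.le_logb_iff_rpow_le (by norm_num) (by linarith)]
    simpa using hn'
  have hlog0 : 0 ≤ Real.log n := Real.log_nonneg (by linarith)
  have hLlog : Real.log n ≤ Real.logb 2 n := by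
    rw [Real.logb, le_div_iff₀ (Real.log_pos (by norm_num))]
    have : Real.log 2 ≤ 1 := by linarith [Real.log_two_lt_d9]
    nlinarith
  set L := Real.logb 2 n
  set A : ℝ := (l : ℝ) ^ k
  set u : ℝ := 1 / (δ - 1)
  have hu : 1 ≤ u := by rw [one_le_div hδ]; linarith
  have hl2 : (2 : ℝ) ≤ l := by exact_mod_cast hl
  have hkA : (k : ℝ) ≤ A :=
    calc (k : ℝ) ≤ 2 ^ k := by exact_mod_cast Nat.lt_two_pow_self.le
      _ ≤ A := pow_le_pow_left₀ (by norm_num) hl2 k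
  have hA4 : 4 ≤ A :=
    calc (4 : ℝ) = 2 ^ 2 := by norm_num
      _ ≤ 2 ^ k := pow_le_pow_right₀ (by norm_num) (by omega)
      _ ≤ A := pow_le_pow_left₀ (by norm_num) hl2 k
  have hxle : x ≤ 32 * A ^ 3 * u ^ 2 * L := by
    have : x = 32 * k * A ^ 2 * Real.log n * u ^ 2 := by
      simp only [hx, A, u, mul_comm 2 k, pow_mul]
      field_simp
    rw [this]
    calc 32 * k * A ^ 2 * Real.log n * u ^ 2 ≤ 32 * A * A ^ 2 * L * u ^ 2 := by gcongr
      _ = _ := by ring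
  have h1 : 1 ≤ A ^ 3 * u ^ 2 * L :=
    one_le_mul_of_one_le_of_one_le (one_le_mul_of_one_le_of_one_le
      (one_le_pow₀ (by linarith)) (one_le_pow₀ hu)) hL1
  have hceil : (⌈x⌉₊ : ℝ) < x + 1 := Nat.ceil_lt_add_one (by positivity)
  calc (⌈x⌉₊ : ℝ) ≤ 4 ^ 3 * (A ^ 3 * u ^ 2 * L) := by linarith
    _ ≤ A ^ 3 * (A ^ 3 * u ^ 6 * L) := by
      gcongr
      · norm_num
    _ = (A * u) ^ 6 * L := by ring
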